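/- Let f, g be smooth functions satisfying the Lax pair (∂_{t₂} - λ∂_{y₂})Ψ = f(∂_{t₁} - λ∂_{y₁})Ψ, (∂_{t₃} - λ∂_{y₃})Ψ = g(∂_{t₁} - λ∂_{y₁})Ψ. Commutativity of these two vector fields for all λ is equivalent to the two-component first-order quasilinear system: f g_{y₁} - g f_{y₁} + f_{y₃} - g_{y₂} = 0 and g f_{t₁} - f g_{t₁} + g_{t₂} - f_{t₃} = 0. -/

import Mathlib

/- STATEMENT 9: For smooth f, g, the vector fields
(∂_{t₂} - λ∂_{y₂}) - f(∂_{t₁} - λ∂_{y₁}) and (∂_{t₃} - λ∂_{y₃}) - g(∂_{t₁} - λ∂_{y₁})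
commute for all λ iff
f g_{y₁} - g f_{y₁} + f_{y₃} - g_{y₂} = 0 and g f_{t₁} - f g_{t₁} + g_{t₂} - f_{t₃} = 0.
Coordinates on ℝ⁶: 0 = t₁, 1 = t₂, 2 = t₃, 3 = y₁, 4 = y₂, 5 = y₃. -/

noncomputable def pd {n : ℕ} (i : Fin n) (f : (Fin n → ℝ) → ℝ) : (Fin n → ℝ) → ℝ :=
  fun x => fderiv ℝ f x (Pi.single i 1)

/-- (∂_{t₂} - λ∂_{y₂})Ψ - f(∂_{t₁} - λ∂_{y₁})Ψ -/
noncomputable def Aop (f : (Fin 6 → ℝ) → ℝ) (lam : ℝ) (Ψ : (Fin 6 → ℝ) → ℝ) :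
    (Fin 6 → ℝ) → ℝ :=
  fun p => pd 1 Ψ p - lam * pd 4 Ψ p - f p * (pd 0 Ψ p - lam * pd 3 Ψ p)

/-- (∂_{t₃} - λ∂_{y₃})Ψ - g(∂_{t₁} - λ∂_{y₁})Ψ -/
noncomputable def Bop (g : (Fin 6 → ℝ) → ℝ) (lam : ℝ) (Ψ : (Fin 6 → ℝ) → ℝ) :
    (Fin 6 → ℝ) → ℝ :=
  fun p => pd 2 Ψ p - lam * pd 5 Ψ p - g p * (pd 0 Ψ p - lam * pd 3 Ψ p)

theorem pd_smooth (i : Fin 6) {h : (Fin 6 → ℝ) → ℝ} (hh : ContDiff ℝ (⊤ : ℕ∞) h) :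
    ContDiff ℝ (⊤ : ℕ∞) (pd i h) := by
  unfold pd
  exact (hh.fderiv_right (m := (⊤ : ℕ∞)) (by simp)).clm_apply contDiff_const

theorem pd_comm (i j : Fin 6) {h : (Fin 6 → ℝ) → ℝ} (hh : ContDiff ℝ (⊤ : ℕ∞) h)
    (p : Fin 6 → ℝ) : pd i (pd j h) p = pd j (pd i h) p := by
  have hd : DifferentiableAt ℝ (fderiv ℝ h) p :=
    ((hh.fderiv_right (m := (⊤ : ℕ∞)) (by simp)).differentiable (by simp)) p
  have key : ∀ a b : Fin 6, pd a (pd b h) p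
      = fderiv ℝ (fderiv ℝ h) p (Pi.single a 1) (Pi.single b 1) := by
    intro a b
    unfold pd
    rw [fderiv_clm_apply hd (differentiableAt_const _)]
    simp
  have hs : IsSymmSndFDerivAt ℝ h p :=
    hh.contDiffAt.isSymmSndFDerivAt (by simpa using (WithTop.coe_le_coe.2 (le_top : (2 : ℕ∞) ≤ ⊤)))
  rw [key, key]
  exact hs.eq _ _

theorem pd_op (i a b : Fin 6) (lam : ℝ) {g h : (Fin 6 → ℝ) → ℝ}
    (hg : ContDiff ℝ (⊤ : ℕ∞) g) (hh : ContDiff ℝ (⊤ : ℕ∞) h) (p : Fin 6 → ℝ) :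
    pd i (fun p => pd a h p - lam * pd b h p - g p * (pd 0 h p - lam * pd 3 h p)) p
    = pd i (pd a h) p - lam * pd i (pd b h) p
      - (pd i g p * (pd 0 h p - lam * pd 3 h p)
        + g p * (pd i (pd 0 h) p - lam * pd i (pd 3 h) p)) := by
  have d : ∀ j, HasFDerivAt (pd j h) (fderiv ℝ (pd j h) p) p := fun j =>
    ((pd_smooth j hh).differentiable (by simp) p).hasFDerivAt
  have dg : HasFDerivAt g (fderiv ℝ g p) p := (hg.differentiable (by simp) p).hasFDerivAt
  have H := (((d a).sub ((d b).const_mul lam)).sub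
    (dg.mul ((d 0).sub ((d 3).const_mul lam)))).fderiv
  have H2 := congrArg (fun L => L (Pi.single i 1)) H
  refine Eq.trans H2 ?_
  simp [pd]
  ring

theorem comm_formula (f g h : (Fin 6 → ℝ) → ℝ) (hf : ContDiff ℝ (⊤ : ℕ∞) f)
    (hg : ContDiff ℝ (⊤ : ℕ∞) g) (hh : ContDiff ℝ (⊤ : ℕ∞) h) (lam : ℝ) (p : Fin 6 → ℝ) :
    Aop f lam (Bop g lam h) p - Bop g lam (Aop f lam h) p
    = -((g p * pd 0 f p - f p * pd 0 g p + pd 1 g p - pd 2 f p)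
        + lam * (f p * pd 3 g p - g p * pd 3 f p + pd 5 f p - pd 4 g p))
      * (pd 0 h p - lam * pd 3 h p) := by
  unfold Aop Bop
  simp only [pd_op _ _ _ lam hg hh, pd_op _ _ _ lam hf hh]
  simp only [pd_comm 1 0 hh, pd_comm 2 0 hh, pd_comm 3 0 hh, pd_comm 4 0 hh, pd_comm 5 0 hh,
    pd_comm 2 1 hh, pd_comm 3 1 hh, pd_comm 5 1 hh,
    pd_comm 3 2 hh, pd_comm 4 2 hh,
    pd_comm 4 3 hh, pd_comm 5 3 hh, pd_comm 5 4 hh]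
  ring

theorem stmt9 (f g : (Fin 6 → ℝ) → ℝ) (hf : ContDiff ℝ (⊤ : ℕ∞) f) (hg : ContDiff ℝ (⊤ : ℕ∞) g) :
    (∀ (lam : ℝ) (Ψ : (Fin 6 → ℝ) → ℝ), ContDiff ℝ (⊤ : ℕ∞) Ψ →
        ∀ p, Aop f lam (Bop g lam Ψ) p = Bop g lam (Aop f lam Ψ) p) ↔
    ((∀ p, f p * pd 3 g p - g p * pd 3 f p + pd 5 f p - pd 4 g p = 0) ∧
     (∀ p, g p * pd 0 f p - f p * pd 0 g p + pd 1 g p - pd 2 f p = 0)) := by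
  constructor
  · intro H
    have hΨ : ContDiff ℝ (⊤ : ℕ∞) (fun x : Fin 6 → ℝ => x 0) := contDiff_apply ℝ ℝ 0
    have hpd : ∀ (i : Fin 6) (p : Fin 6 → ℝ), pd i (fun x : Fin 6 → ℝ => x 0) p
        = (Pi.single i 1 : Fin 6 → ℝ) 0 := by
      intro i p
      have := (hasFDerivAt_apply (𝕜 := ℝ) (0 : Fin 6) p).fderiv
      unfold pd
      rw [this]
      rfl
    have K : ∀ (lam : ℝ) p, (g p * pd 0 f p - f p * pd 0 g p + pd 1 g p - pd 2 f p)
        + lam * (f p * pd 3 g p - g p * pd 3 f p + pd 5 f p - pd 4 g p) = 0 := by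
      intro lam p
      have h1 := comm_formula f g _ hf hg hΨ lam p
      rw [H lam _ hΨ p, hpd, hpd] at h1
      simp at h1
      linarith
    refine ⟨fun p => ?_, fun p => ?_⟩
    · have := K 0 p
      have := K 1 p
      linarith
    · have := K 0 p
      linarith
  · rintro ⟨h1, h2⟩ lam Ψ hΨ p
    have h := comm_formula f g Ψ hf hg hΨ lam p
    rw [h1, h2] at h
    linarith
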